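/- arXiv:2303.07743 — 2 statements merged into one kernel-verified Lean document; each statement's English description precedes it below -/
import Mathlib

section
/- Let ρ be a Borel measure on ℝ with ρ({0}) = 0 and ∫_ℝ min(|z|, z²) dρ(z) < ∞, and let π : ℝ → [0,∞) be Lebesgue-integrable. Define the double integrated tail ρ̄̄(u) := ∫_u^∞ ρ((s,∞)) ds for u > 0, ρ̄̄(u) := ∫_{−∞}^u ρ((−∞,s)) ds for u < 0, ρ̄̄(0) := 0. Then for every smooth compactly supported f : ℝ → ℝ, ∫_ℝ ∫_ℝ ( f(x+z) − f(x) − z f'(x) ) dρ(z) π(x) dx = ∫_ℝ ( ∫_ℝ ρ̄̄(y−x) π(x) dx ) f''(y) dy, both double integrals being absolutely convergent. -/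
open MeasureTheory Set Filter

/-- The kernel whose integral over `z` against `ρ` is the double integrated tail of `ρ` at `u`. -/
noncomputable def tailKernel (z u : ℝ) : ℝ :=
  if 0 < u then max (z - u) 0 else if u < 0 then max (u - z) 0 else 0

theorem measurable_tailKernel : Measurable fun p : ℝ × ℝ => tailKernel p.1 p.2 := by
  unfold tailKernel
  refine Measurable.ite (measurableSet_lt measurable_const measurable_snd) (by fun_prop) ?_
  exact Measurable.ite (measurableSet_lt measurable_snd measurable_const) (by fun_prop) (by fun_prop)

theorem tailKernel_nonneg (z u : ℝ) : 0 ≤ tailKernel z u := by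
  unfold tailKernel
  split_ifs <;> simp

theorem tailKernel_le_abs (z u : ℝ) : tailKernel z u ≤ |z| := by
  unfold tailKernel
  have h1 := le_abs_self z
  have h2 := neg_abs_le z
  split_ifs
  · exact max_le (by linarith) (abs_nonneg z)
  · exact max_le (by linarith) (abs_nonneg z)
  · exact abs_nonneg z

theorem tailKernel_eq_zero {z u : ℝ} (h : |z| ≤ |u|) : tailKernel z u = 0 := by
  unfold tailKernel
  have h1 := le_abs_self z
  have h2 := neg_abs_le z
  split_ifs with hu hu'
  · rw [abs_of_pos hu] at h
    exact max_eq_right (by linarith)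
  · rw [abs_of_neg hu'] at h
    exact max_eq_right (by linarith)
  · rfl

theorem tailKernel_zero_right (z : ℝ) : tailKernel z 0 = 0 := by
  simp [tailKernel]

theorem tailKernel_le_const_mul_min {z u : ℝ} (hu : u ≠ 0) :
    tailKernel z u ≤ (1 + |u|⁻¹) * min |z| (z ^ 2) := by
  have hu' : 0 < |u| := abs_pos.2 hu
  have hm : 0 ≤ min |z| (z ^ 2) := le_min (abs_nonneg z) (sq_nonneg z)
  rcases le_or_gt |z| |u| with h | h
  · rw [tailKernel_eq_zero h]
    positivity
  refine (tailKernel_le_abs z u).trans ?_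
  have hi : 0 < |u|⁻¹ := inv_pos.2 hu'
  rcases le_total |z| (z ^ 2) with hz | hz
  · rw [min_eq_left hz]
    nlinarith [abs_nonneg z]
  · rw [min_eq_right hz, ← sq_abs z]
    have : 1 ≤ |u|⁻¹ * |z| := by
      rw [inv_mul_eq_div, one_le_div hu']
      exact h.le
    nlinarith [sq_nonneg |z|, abs_nonneg z, mul_le_mul_of_nonneg_right this (abs_nonneg z)]

/-- Taylor's formula at order two with integral remainder, written with `tailKernel`. -/
theorem sub_sub_mul_eq_integral_tailKernel {f f' f'' : ℝ → ℝ} (hf : ∀ x, HasDerivAt f (f' x) x)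
    (hf' : ∀ x, HasDerivAt f' (f'' x) x) (hf'' : Continuous f'') (x z : ℝ) :
    f (x + z) - f x - z * f' x = ∫ y, tailKernel z (y - x) * f'' y := by
  have htaylor : ∫ u in (0 : ℝ)..z, (z - u) * f'' (x + u) = f (x + z) - f x - z * f' x := by
    have hd : ∀ u ∈ uIcc 0 z, HasDerivAt (fun u => (z - u) * f' (x + u) + f (x + u))
        ((z - u) * f'' (x + u)) u := by
      intro u _
      have h1 := (hasDerivAt_id u).const_sub z
      have h2 := (hf' (x + u)).comp_const_add x u
      have h3 := (hf (x + u)).comp_const_add x u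
      exact ((h1.mul h2).add h3).congr_deriv (by simp)
    have hc : Continuous fun u => (z - u) * f'' (x + u) := by fun_prop
    rw [intervalIntegral.integral_eq_sub_of_hasDerivAt hd (hc.intervalIntegrable _ _)]
    simp
    ring
  have hshift : ∫ y, tailKernel z (y - x) * f'' y = ∫ u, tailKernel z u * f'' (x + u) := by
    rw [← integral_add_right_eq_self _ x]
    simp [add_comm]
  rw [hshift, ← htaylor]
  rcases le_total 0 z with hz | hz
  · rw [intervalIntegral.integral_of_le hz, ← integral_indicator measurableSet_Ioc]
    congr 1 with u
    by_cases hu : u ∈ Ioc 0 z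
    · rw [indicator_of_mem hu, tailKernel, if_pos hu.1, max_eq_left (by linarith [hu.2])]
    · rw [indicator_of_notMem hu, tailKernel]
      rw [mem_Ioc, not_and_or, not_lt, not_le] at hu
      split_ifs with h1 h2
      · rw [max_eq_right (by rcases hu with h | h <;> linarith), zero_mul]
      · rw [max_eq_right (by linarith), zero_mul]
      · rw [zero_mul]
  · rw [intervalIntegral.integral_of_ge hz, ← integral_neg, ← integral_Ico_eq_integral_Ioc,
      ← integral_indicator measurableSet_Ico]
    congr 1 with u
    by_cases hu : u ∈ Ico z 0
    · rw [indicator_of_mem hu, tailKernel, if_neg (by linarith [hu.2]), if_pos hu.2,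
        max_eq_left (by linarith [hu.1])]
      ring
    · rw [indicator_of_notMem hu, tailKernel]
      rw [mem_Ico, not_and_or, not_lt, not_le] at hu
      split_ifs with h1 h2
      · rw [max_eq_right (by linarith), zero_mul]
      · rw [max_eq_right (by rcases hu with h | h <;> linarith), zero_mul]
      · rw [zero_mul]

theorem lintegral_tailKernel_mul_le {g : ℝ → ℝ} {M : ℝ} (hM : ∀ y, |g y| ≤ M) (x z : ℝ) :
    ∫⁻ y, ENNReal.ofReal |tailKernel z (y - x) * g y| ≤
      ((∫⁻ y, ENNReal.ofReal |g y|) + ENNReal.ofReal (2 * M)) *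
        ENNReal.ofReal (min |z| (z ^ 2)) := by
  have hM0 : 0 ≤ M := (abs_nonneg _).trans (hM 0)
  have habs (y : ℝ) : |tailKernel z (y - x) * g y| ≤ |z| * |g y| := by
    rw [abs_mul, abs_of_nonneg (tailKernel_nonneg _ _)]
    exact mul_le_mul_of_nonneg_right (tailKernel_le_abs _ _) (abs_nonneg _)
  rcases le_total |z| (z ^ 2) with hz | hz
  · rw [min_eq_left hz, mul_comm]
    calc ∫⁻ y, ENNReal.ofReal |tailKernel z (y - x) * g y|
        ≤ ∫⁻ y, ENNReal.ofReal |z| * ENNReal.ofReal |g y| := by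
          refine lintegral_mono fun y => ?_
          rw [← ENNReal.ofReal_mul (abs_nonneg _)]
          exact ENNReal.ofReal_le_ofReal (habs y)
      _ = ENNReal.ofReal |z| * ∫⁻ y, ENNReal.ofReal |g y| :=
          lintegral_const_mul' _ _ ENNReal.ofReal_ne_top
      _ ≤ _ := by
          gcongr
          exact le_self_add
  · rw [min_eq_right hz]
    calc ∫⁻ y, ENNReal.ofReal |tailKernel z (y - x) * g y|
        ≤ ∫⁻ y, (Icc (x - |z|) (x + |z|)).indicator
            (fun _ => ENNReal.ofReal (|z| * M)) y := by
          refine lintegral_mono fun y => ?_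
          by_cases hy : y ∈ Icc (x - |z|) (x + |z|)
          · rw [indicator_of_mem hy]
            exact ENNReal.ofReal_le_ofReal
              ((habs y).trans (mul_le_mul_of_nonneg_left (hM y) (abs_nonneg z)))
          · have : |z| ≤ |y - x| := by
              by_contra! h
              rw [abs_lt] at h
              exact hy ⟨by linarith, by linarith⟩
            simp [tailKernel_eq_zero this]
      _ = ENNReal.ofReal (2 * M) * ENNReal.ofReal (z ^ 2) := by
          rw [lintegral_indicator_const measurableSet_Icc, Real.volume_Icc,
            ← ENNReal.ofReal_mul (by positivity), ← ENNReal.ofReal_mul (by positivity), ← sq_abs z]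
          congr 1
          ring
      _ ≤ _ := by
          gcongr
          exact le_add_self

theorem sFinite_of_lintegral_lt_top {α : Type*} [MeasurableSpace α] {μ : Measure α}
    {w : α → ENNReal} (hw : Measurable w) (hw0 : ∀ᵐ x ∂μ, w x ≠ 0)
    (hwint : ∫⁻ x, w x ∂μ < ⊤) : SFinite μ := by
  have := isFiniteMeasure_withDensity hwint.ne
  rw [← withDensity_inv_same hw hw0 ((ae_lt_top hw hwint.ne).mono fun _ h => h.ne)]
  infer_instance

section LevyMeasure

variable {ρ : Measure ℝ}

theorem sFinite_of_lintegral_min_abs_sq_lt_top (hρ0 : ρ {0} = 0)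
    (hρint : ∫⁻ z, ENNReal.ofReal (min |z| (z ^ 2)) ∂ρ < ⊤) : SFinite ρ := by
  refine sFinite_of_lintegral_lt_top (by fun_prop) ?_ hρint
  have h0 : ∀ᵐ z ∂ρ, z ≠ 0 := by simpa [ae_iff] using hρ0
  filter_upwards [h0] with z hz
  have : 0 < min |z| (z ^ 2) := lt_min (abs_pos.2 hz) (by positivity)
  exact (ENNReal.ofReal_pos.2 this).ne'

theorem integrable_tailKernel (hρint : ∫⁻ z, ENNReal.ofReal (min |z| (z ^ 2)) ∂ρ < ⊤) (u : ℝ) :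
    Integrable (fun z => tailKernel z u) ρ := by
  rcases eq_or_ne u 0 with rfl | hu
  · simp [tailKernel_zero_right]
  have hm (z : ℝ) : 0 ≤ min |z| (z ^ 2) := le_min (abs_nonneg z) (sq_nonneg z)
  have hmin : Integrable (fun z : ℝ => min |z| (z ^ 2)) ρ := by
    refine ⟨by fun_prop, ?_⟩
    rwa [hasFiniteIntegral_iff_ofReal (Eventually.of_forall hm)]
  refine (hmin.const_mul (1 + |u|⁻¹)).mono'
    (measurable_tailKernel.comp measurable_prodMk_right).aestronglyMeasurable
    (Eventually.of_forall fun z => ?_)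
  rw [Real.norm_of_nonneg (tailKernel_nonneg z u)]
  exact tailKernel_le_const_mul_min hu

theorem integral_tail_eq_integral_tailKernel_of_pos [SFinite ρ]
    (hρint : ∫⁻ z, ENNReal.ofReal (min |z| (z ^ 2)) ∂ρ < ⊤) {u : ℝ} (hu : 0 < u) :
    ∫ s in Ioi u, (ρ (Ioi s)).toReal = ∫ z, tailKernel z u ∂ρ := by
  have hK := integrable_tailKernel hρint u
  have hS : MeasurableSet {p : ℝ × ℝ | p.1 < p.2} := measurableSet_lt measurable_fst measurable_snd
  have hswap : ∫⁻ s in Ioi u, ρ (Ioi s) = ∫⁻ z, ENNReal.ofReal (tailKernel z u) ∂ρ := by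
    calc ∫⁻ s in Ioi u, ρ (Ioi s)
        = ((volume.restrict (Ioi u)).prod ρ) {p : ℝ × ℝ | p.1 < p.2} := (Measure.prod_apply hS).symm
      _ = ∫⁻ z, (volume.restrict (Ioi u)) (Iio z) ∂ρ := Measure.prod_apply_symm hS
      _ = _ := by
          refine lintegral_congr fun z => ?_
          rw [Measure.restrict_apply measurableSet_Iio, Iio_inter_Ioi, Real.volume_Ioo, tailKernel,
            if_pos hu, ENNReal.ofReal_max, ENNReal.ofReal_zero, max_eq_left zero_le]
  have hmeas : Measurable fun s => ρ (Ioi s) :=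
    Antitone.measurable fun _ _ h => measure_mono (Ioi_subset_Ioi h)
  have hfin : ∫⁻ s in Ioi u, ρ (Ioi s) ≠ ⊤ := by
    rw [hswap]
    exact hK.lintegral_lt_top.ne
  rw [integral_toReal hmeas.aemeasurable (ae_lt_top hmeas hfin), hswap,
    integral_eq_lintegral_of_nonneg_ae (Eventually.of_forall fun z => tailKernel_nonneg z u) hK.1]

theorem integral_tail_eq_integral_tailKernel_of_neg [SFinite ρ]
    (hρint : ∫⁻ z, ENNReal.ofReal (min |z| (z ^ 2)) ∂ρ < ⊤) {u : ℝ} (hu : u < 0) :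
    ∫ s in Iio u, (ρ (Iio s)).toReal = ∫ z, tailKernel z u ∂ρ := by
  have hK := integrable_tailKernel hρint u
  have hS : MeasurableSet {p : ℝ × ℝ | p.2 < p.1} := measurableSet_lt measurable_snd measurable_fst
  have hswap : ∫⁻ s in Iio u, ρ (Iio s) = ∫⁻ z, ENNReal.ofReal (tailKernel z u) ∂ρ := by
    calc ∫⁻ s in Iio u, ρ (Iio s)
        = ((volume.restrict (Iio u)).prod ρ) {p : ℝ × ℝ | p.2 < p.1} := (Measure.prod_apply hS).symm
      _ = ∫⁻ z, (volume.restrict (Iio u)) (Ioi z) ∂ρ := Measure.prod_apply_symm hS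
      _ = _ := by
          refine lintegral_congr fun z => ?_
          rw [Measure.restrict_apply measurableSet_Ioi, Ioi_inter_Iio, Real.volume_Ioo, tailKernel,
            if_neg hu.not_gt, if_pos hu, ENNReal.ofReal_max, ENNReal.ofReal_zero,
            max_eq_left zero_le]
  have hmeas : Measurable fun s => ρ (Iio s) :=
    Monotone.measurable fun _ _ h => measure_mono (Iio_subset_Iio h)
  have hfin : ∫⁻ s in Iio u, ρ (Iio s) ≠ ⊤ := by
    rw [hswap]
    exact hK.lintegral_lt_top.ne
  rw [integral_toReal hmeas.aemeasurable (ae_lt_top hmeas hfin), hswap,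
    integral_eq_lintegral_of_nonneg_ae (Eventually.of_forall fun z => tailKernel_nonneg z u) hK.1]

theorem stronglyMeasurable_integral_tailKernel [SFinite ρ] :
    StronglyMeasurable fun u => ∫ z, tailKernel z u ∂ρ :=
  measurable_tailKernel.stronglyMeasurable.integral_prod_left'

variable {g : ℝ → ℝ}

theorem lintegral_lintegral_tailKernel_mul_le {M : ℝ} (hM : ∀ y, |g y| ≤ M) (x : ℝ) :
    ∫⁻ z, (∫⁻ y, ENNReal.ofReal |tailKernel z (y - x) * g y|) ∂ρ ≤
      ((∫⁻ y, ENNReal.ofReal |g y|) + ENNReal.ofReal (2 * M)) *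
        ∫⁻ z, ENNReal.ofReal (min |z| (z ^ 2)) ∂ρ := by
  rw [← lintegral_const_mul _ (by fun_prop)]
  exact lintegral_mono fun z => lintegral_tailKernel_mul_le hM x z

theorem measurable_tailKernel_sub_mul (hg : Measurable g) (x : ℝ) :
    Measurable (Function.uncurry fun z y => tailKernel z (y - x) * g y) :=
  (measurable_tailKernel.comp (measurable_fst.prodMk (measurable_snd.sub_const x))).mul
    (hg.comp measurable_snd)

theorem lintegral_integral_tailKernel_mul_le [SFinite ρ] (hg : Measurable g) {M : ℝ}
    (hM : ∀ y, |g y| ≤ M) (x : ℝ) :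
    ∫⁻ y, ENNReal.ofReal |(∫ z, tailKernel z (y - x) ∂ρ) * g y| ≤
      ((∫⁻ y, ENNReal.ofReal |g y|) + ENNReal.ofReal (2 * M)) *
        ∫⁻ z, ENNReal.ofReal (min |z| (z ^ 2)) ∂ρ := by
  refine le_trans ?_ (lintegral_lintegral_tailKernel_mul_le hM x)
  rw [lintegral_lintegral_swap
    (measurable_tailKernel_sub_mul hg x).abs.ennreal_ofReal.aemeasurable]
  refine lintegral_mono fun y => ?_
  simp only [← Real.enorm_eq_ofReal_abs, ← integral_mul_const]
  exact enorm_integral_le_lintegral_enorm _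

theorem integrable_tailKernel_sub_mul [SFinite ρ]
    (hρint : ∫⁻ z, ENNReal.ofReal (min |z| (z ^ 2)) ∂ρ < ⊤) (hg : Measurable g)
    (hgint : ∫⁻ y, ENNReal.ofReal |g y| < ⊤) {M : ℝ} (hM : ∀ y, |g y| ≤ M) (x : ℝ) :
    Integrable (Function.uncurry fun z y => tailKernel z (y - x) * g y) (ρ.prod volume) := by
  have hm := measurable_tailKernel_sub_mul hg x
  refine ⟨hm.aestronglyMeasurable, ?_⟩
  rw [HasFiniteIntegral, lintegral_prod _ hm.enorm.aemeasurable]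
  simp only [Function.uncurry_apply_pair, Real.enorm_eq_ofReal_abs]
  exact (lintegral_lintegral_tailKernel_mul_le hM x).trans_lt
    (ENNReal.mul_lt_top (ENNReal.add_lt_top.2 ⟨hgint, ENNReal.ofReal_lt_top⟩) hρint)

end LevyMeasure

/-- the compensated small-jump part of the generator, tested against a
density `π`, equals the second weak derivative of the convolution of `π` with the
double integrated tail `ρ̄̄`; both double integrals converge absolutely. -/
theorem compensated_jump_part_eq_second_weak_derivative_of_double_tail_convolution
    (ρ : Measure ℝ) (hρ0 : ρ {0} = 0)
    (hρint : ∫⁻ z, ENNReal.ofReal (min |z| (z ^ 2)) ∂ρ < ⊤)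
    (π : ℝ → ℝ) (hπ_int : Integrable π) (hπ_nonneg : ∀ x, 0 ≤ π x)
    (dtail : ℝ → ℝ)
    (hdtail_pos : ∀ u > (0 : ℝ), dtail u = ∫ s in Ioi u, (ρ (Ioi s)).toReal)
    (hdtail_neg : ∀ u < (0 : ℝ), dtail u = ∫ s in Iio u, (ρ (Iio s)).toReal)
    (hdtail_zero : dtail 0 = 0)
    (f : ℝ → ℝ) (hf : ContDiff ℝ (⊤ : ℕ∞) f) (hf_supp : HasCompactSupport f) :
    (∫⁻ x, ∫⁻ z, ENNReal.ofReal |(f (x + z) - f x - z * deriv f x) * π x| ∂ρ) < ⊤ ∧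
    (∫⁻ y, ∫⁻ x, ENNReal.ofReal |dtail (y - x) * π x * deriv (deriv f) y|) < ⊤ ∧
    ∫ x, (∫ z, (f (x + z) - f x - z * deriv f x) ∂ρ) * π x
      = ∫ y, (∫ x, dtail (y - x) * π x) * deriv (deriv f) y := by
  have := sFinite_of_lintegral_min_abs_sq_lt_top hρ0 hρint
  set g := deriv (deriv f) with hg_def
  have hf1 : ContDiff ℝ (⊤ : ℕ∞) (deriv f) := (contDiff_infty_iff_deriv.1 hf).2
  have hgc : Continuous g := hf1.continuous_deriv (by simp)
  have hg_supp : HasCompactSupport g := hf_supp.deriv.deriv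
  obtain ⟨M, hM⟩ := hg_supp.exists_bound_of_continuous hgc
  have hg_int : ∫⁻ y, ENNReal.ofReal |g y| < ⊤ := by
    simpa only [← Real.enorm_eq_ofReal_abs] using!
      (hgc.integrable_of_hasCompactSupport (μ := volume) hg_supp).2
  have htaylor (x z : ℝ) :
      f (x + z) - f x - z * deriv f x = ∫ y, tailKernel z (y - x) * g y :=
    sub_sub_mul_eq_integral_tailKernel
      (fun x => (hf.differentiable (by simp) x).hasDerivAt)
      (fun x => (hf1.differentiable (by simp) x).hasDerivAt) hgc x z
  have hdtail : dtail = fun u => ∫ z, tailKernel z u ∂ρ := by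
    funext u
    rcases lt_trichotomy u 0 with hu | rfl | hu
    · rw [hdtail_neg u hu, integral_tail_eq_integral_tailKernel_of_neg hρint hu]
    · simp [hdtail_zero, tailKernel_zero_right]
    · rw [hdtail_pos u hu, integral_tail_eq_integral_tailKernel_of_pos hρint hu]
  have hdtail_meas : Measurable dtail :=
    hdtail ▸ stronglyMeasurable_integral_tailKernel.measurable
  set C := ((∫⁻ y, ENNReal.ofReal |g y|) + ENNReal.ofReal (2 * M)) *
    ∫⁻ z, ENNReal.ofReal (min |z| (z ^ 2)) ∂ρ
  have hC : C < ⊤ :=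
    ENNReal.mul_lt_top (ENNReal.add_lt_top.2 ⟨hg_int, ENNReal.ofReal_lt_top⟩) hρint
  have hπC : ∫⁻ x, C * ENNReal.ofReal |π x| < ⊤ := by
    rw [lintegral_const_mul' _ _ hC.ne]
    refine ENNReal.mul_lt_top hC ?_
    simpa only [← Real.enorm_eq_ofReal_abs] using! hπ_int.2
  have hjump (x : ℝ) :
      ∫⁻ z, ENNReal.ofReal |(f (x + z) - f x - z * deriv f x) * π x| ∂ρ ≤
        C * ENNReal.ofReal |π x| := by
    simp only [abs_mul _ (π x), ENNReal.ofReal_mul (abs_nonneg _)]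
    rw [lintegral_mul_const' _ _ ENNReal.ofReal_ne_top]
    gcongr
    refine le_trans (lintegral_mono fun z => ?_) (lintegral_lintegral_tailKernel_mul_le hM x)
    rw [htaylor]
    simp only [← Real.enorm_eq_ofReal_abs]
    exact enorm_integral_le_lintegral_enorm _
  have hconv (x : ℝ) :
      ∫⁻ y, ENNReal.ofReal |dtail (y - x) * π x * g y| ≤ C * ENNReal.ofReal |π x| := by
    simp only [mul_right_comm _ (π x), abs_mul _ (π x), ENNReal.ofReal_mul (abs_nonneg _)]
    rw [lintegral_mul_const' _ _ ENNReal.ofReal_ne_top, hdtail]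
    gcongr
    exact lintegral_integral_tailKernel_mul_le hgc.measurable hM x
  have hmeas : AEStronglyMeasurable (Function.uncurry fun x y => dtail (y - x) * π x * g y)
      (volume.prod volume) :=
    ((hdtail_meas.comp (measurable_snd.sub measurable_fst)).aestronglyMeasurable.mul
      hπ_int.1.comp_fst).mul (hgc.measurable.comp measurable_snd).aestronglyMeasurable
  have hint : Integrable (Function.uncurry fun x y => dtail (y - x) * π x * g y)
      (volume.prod volume) := by
    refine ⟨hmeas, ?_⟩
    rw [HasFiniteIntegral, lintegral_prod _ hmeas.enorm]
    simp only [Function.uncurry_apply_pair, Real.enorm_eq_ofReal_abs]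
    exact (lintegral_mono hconv).trans_lt hπC
  refine ⟨(lintegral_mono hjump).trans_lt hπC, ?_, ?_⟩
  · have hfin := hint.2
    rw [HasFiniteIntegral, lintegral_prod_symm _ hmeas.enorm] at hfin
    simpa only [Function.uncurry_apply_pair, Real.enorm_eq_ofReal_abs] using hfin
  · calc ∫ x, (∫ z, (f (x + z) - f x - z * deriv f x) ∂ρ) * π x
        = ∫ x, ∫ y, dtail (y - x) * π x * g y := by
          refine integral_congr_ae (Eventually.of_forall fun x => ?_)
          simp only [htaylor, mul_right_comm _ (π x), integral_mul_const]
          rw [integral_integral_swap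
            (integrable_tailKernel_sub_mul hρint hgc.measurable hg_int hM x)]
          simp only [integral_mul_const, hdtail]
      _ = ∫ y, ∫ x, dtail (y - x) * π x * g y := integral_integral_swap hint
      _ = ∫ y, (∫ x, dtail (y - x) * π x) * g y := by simp only [integral_mul_const]
end

section
/- Let μ be a nonzero finite Borel measure on ℝ with μ((−∞,0]) = 0 and ∫_{(0,∞)} z dμ(z) < ∞. Let α, C, C', x₀ > 0 and let π : ℝ → [0,∞) be measurable and Lebesgue-integrable with π = 0 on (−∞,0], π(z) > 0 for all z > 0, lim_{x→∞} π(x)e^{αx} = C, ∫_0^x π(z) dz ≤ C' x π(x) for all x ∈ (0,x₀], and π bounded away from 0 on every compact subset of (0,∞). Set φ(x) := −(1/π(x)) ∫_0^x μ((x−z,∞)) π(z) dz for x > 0. Let ε ∈ (0,1) and let f₀ : (0,∞) → ℝ be continuously differentiable with f₀(x) = 1 − ln x for x ∈ (0, ε] and f₀(x) = 1 + x for x ≥ 1/ε, and f₀ ≥ 1 everywhere. Then there exist c > 0, d ≥ 0 and a compact set K ⊂ (0,∞) such that for all x > 0: φ(x) f₀'(x) + ∫_{(0,∞)} ( f₀(x+z)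 − f₀(x) ) dμ(z) ≤ −c + d·1_K(x). -/
open MeasureTheory Set Filter

lemma ae_pos_of_measure_Iic_eq_zero {μ : Measure ℝ} (hμ : μ (Iic 0) = 0) :
    ∀ᵐ z ∂μ, (0 : ℝ) < z := by
  rw [ae_iff]
  simpa [Iic] using hμ

lemma integral_id_pos {μ : Measure ℝ} (hμne : μ ≠ 0) (hμ : μ (Iic 0) = 0)
    (hint : Integrable (fun z : ℝ => z) μ) : 0 < ∫ z, z ∂μ := by
  have hpos := ae_pos_of_measure_Iic_eq_zero hμ
  rw [integral_pos_iff_support_of_nonneg_ae (hpos.mono fun z hz => hz.le) hint]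
  rw [pos_iff_ne_zero]
  intro h0
  apply hμne
  rw [← Measure.measure_univ_eq_zero]
  rw [← Iic_union_Ioi (a := (0 : ℝ))]
  refine measure_union_null hμ (measure_mono_null ?_ h0)
  intro z hz
  exact ne_of_gt hz

section Tail

variable (μ : Measure ℝ) [IsFiniteMeasure μ]

lemma antitone_measureReal_Ioi : Antitone fun u : ℝ => μ.real (Ioi u) :=
  fun _ _ h => measureReal_mono (Ioi_subset_Ioi h)

variable {μ}

lemma exists_measureReal_Ioi_pos (hμne : μ ≠ 0) (hμ : μ (Iic 0) = 0) {r : ℝ} (hr : 0 < r) :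
    ∃ δ > (0 : ℝ), δ ≤ r ∧ 0 < μ.real (Ioi δ) := by
  by_contra! h
  have hnull : ∀ n : ℕ, μ (Ioi (r / (n + 1 : ℝ))) = 0 := by
    intro n
    have hn : (1 : ℝ) ≤ n + 1 := by linarith [n.cast_nonneg (α := ℝ)]
    have h1 := h (r / (n + 1)) (by positivity) (div_le_self hr.le hn)
    exact (measureReal_eq_zero_iff).1 (le_antisymm h1 measureReal_nonneg)
  have hIoi : μ (Ioi 0) = 0 := by
    refine measure_mono_null ?_ (measure_iUnion_null hnull)
    intro z hz
    obtain ⟨n, hn⟩ := exists_nat_gt (r / z)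
    refine mem_iUnion.2 ⟨n, ?_⟩
    have hz' : (0 : ℝ) < z := hz
    rw [div_lt_iff₀ hz'] at hn
    have hn1 : (0 : ℝ) < n + 1 := by positivity
    rw [mem_Ioi, div_lt_iff₀ hn1]
    nlinarith
  apply hμne
  rw [← Measure.measure_univ_eq_zero, ← Iic_union_Ioi (a := (0 : ℝ))]
  exact measure_union_null hμ hIoi

/-- A finite truncation of the exponentially weighted tail integral already exceeds the mean. -/
lemma exists_mean_lt_integral_exp_mul_tail (hμne : μ ≠ 0) (hμ : μ (Iic 0) = 0)
    (hint : Integrable (fun z : ℝ => z) μ) {α : ℝ} (hα : 0 < α) :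
    ∃ U > (0 : ℝ), ∫ z, z ∂μ < ∫ u in 0..U, μ.real (Ioi u) * Real.exp (α * u) := by
  have hpos := ae_pos_of_measure_Iic_eq_zero hμ
  have hcake : ∫ z, z ∂μ = ∫ u in Ioi 0, μ.real (Ioi u) :=
    hint.integral_eq_integral_meas_lt (hpos.mono fun z hz => hz.le)
  have htail : IntegrableOn (fun u => μ.real (Ioi u)) (Ioi 0) := by
    by_contra h
    have := integral_id_pos hμne hμ hint
    rw [hcake, integral_undef h] at this
    exact lt_irrefl _ this
  have hii : ∀ a b : ℝ, IntervalIntegrable (fun u => μ.real (Ioi u)) volume a b :=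
    fun a b => (antitone_measureReal_Ioi μ).intervalIntegrable
  have hexp : ∀ a b : ℝ, IntervalIntegrable
      (fun u => μ.real (Ioi u) * (Real.exp (α * u) - 1)) volume a b :=
    fun a b => (hii a b).mul_continuousOn (by fun_prop)
  obtain ⟨δ, hδ, -, hδμ⟩ := exists_measureReal_Ioi_pos hμne hμ one_pos
  have hone : ∀ u : ℝ, 0 < u → 0 < Real.exp (α * u) - 1 := fun u hu => by
    have := Real.one_lt_exp_iff.2 (mul_pos hα hu)
    linarith
  have hκ : 0 < ∫ u in 0..δ, μ.real (Ioi u) * (Real.exp (α * u) - 1) := by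
    refine intervalIntegral.intervalIntegral_pos_of_pos_on (hexp 0 δ) ?_ hδ
    intro u hu
    exact mul_pos (hδμ.trans_le (antitone_measureReal_Ioi μ hu.2.le)) (hone u hu.1)
  have hlim := intervalIntegral_tendsto_integral_Ioi 0 htail tendsto_id
  rw [← hcake] at hlim
  obtain ⟨U, hU, hUδ⟩ :=
    ((hlim.eventually (lt_mem_nhds (sub_lt_self _ hκ))).and (eventually_ge_atTop δ)).exists
  refine ⟨U, hδ.trans_le hUδ, ?_⟩
  have hsplit : ∫ u in 0..U, μ.real (Ioi u) * Real.exp (α * u) =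
      (∫ u in 0..U, μ.real (Ioi u)) +
        ∫ u in 0..U, μ.real (Ioi u) * (Real.exp (α * u) - 1) := by
    rw [← intervalIntegral.integral_add (hii 0 U) (hexp 0 U)]
    congr 1
    ext u
    ring
  have hadj := intervalIntegral.integral_add_adjacent_intervals (hexp 0 δ) (hexp δ U)
  have hnn : 0 ≤ ∫ u in δ..U, μ.real (Ioi u) * (Real.exp (α * u) - 1) :=
    intervalIntegral.integral_nonneg hUδ fun u hu =>
      mul_nonneg measureReal_nonneg (hone u (hδ.trans_le hu.1)).le
  simp only [id] at hU
  linarith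

/-- If `π x * exp (α x)` converges to a positive limit, then `π` is eventually almost
exponentially decreasing, uniformly over bounded shifts. -/
lemma eventually_mul_exp_mul_le {π : ℝ → ℝ} {α C : ℝ} (hC : 0 < C)
    (hπ : Tendsto (fun x => π x * Real.exp (α * x)) atTop (nhds C)) {q : ℝ} (hq0 : 0 < q)
    (hq1 : q < 1) (U : ℝ) :
    ∃ b, ∀ x ≥ b, ∀ z ∈ Icc (x - U) x, q * Real.exp (α * (x - z)) * π x ≤ π z := by
  have hlo : q * (2 * C / (1 + q)) < C := by
    rw [← mul_div_assoc, div_lt_iff₀ (by linarith)]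
    nlinarith
  have hhi : C < 2 * C / (1 + q) := by
    rw [lt_div_iff₀ (by linarith)]
    nlinarith
  obtain ⟨b, hb⟩ := eventually_atTop.1
    ((hπ.eventually (lt_mem_nhds hlo)).and (hπ.eventually (gt_mem_nhds hhi)))
  refine ⟨max b (b + U), fun x hx z hz => ?_⟩
  have hxb : b ≤ x := (le_max_left _ _).trans hx
  have hzb : b ≤ z := by linarith [le_max_right b (b + U), hz.1]
  have h1 := (hb x hxb).2
  have h2 := (hb z hzb).1
  have h3 : q * (π x * Real.exp (α * x)) ≤ π z * Real.exp (α * z) :=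
    (mul_lt_mul_of_pos_left h1 hq0).le.trans h2.le
  have he : Real.exp (α * x) = Real.exp (α * (x - z)) * Real.exp (α * z) := by
    rw [← Real.exp_add]
    congr 1
    ring
  rw [he] at h3
  refine le_of_mul_le_mul_right ?_ (Real.exp_pos (α * z))
  linarith

lemma integrableOn_tail_mul {π : ℝ → ℝ} (hπ : Integrable π) (x : ℝ) (s : Set ℝ) :
    IntegrableOn (fun z => μ.real (Ioi (x - z)) * π z) s := by
  refine (Integrable.bdd_mul (c := μ.real univ) hπ ?_ ?_).integrableOn
  · exact ((antitone_measureReal_Ioi μ).measurable.comp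
      (measurable_const.sub measurable_id)).aestronglyMeasurable
  · refine Eventually.of_forall fun z => ?_
    rw [Real.norm_of_nonneg measureReal_nonneg]
    exact measureReal_mono (subset_univ _)

lemma setIntegral_tail_mul_le {π : ℝ → ℝ} (hπ : Integrable π) (hπ0 : ∀ x, 0 ≤ π x) (x : ℝ)
    (s : Set ℝ) :
    ∫ z in s, μ.real (Ioi (x - z)) * π z ≤ μ.real univ * ∫ z in s, π z := by
  rw [← integral_const_mul]
  exact integral_mono (integrableOn_tail_mul hπ x s) (hπ.integrableOn.const_mul _)
    fun z => mul_le_mul_of_nonneg_right (measureReal_mono (subset_univ _)) (hπ0 z)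

/-- The integrated-tail convolution, relative to `π`, eventually exceeds the mean by a
fixed margin. -/
lemma exists_mean_add_mul_le_setIntegral_tail_mul (hμne : μ ≠ 0) (hμ : μ (Iic 0) = 0)
    (hint : Integrable (fun z : ℝ => z) μ) {α C : ℝ} (hα : 0 < α) (hC : 0 < C) {π : ℝ → ℝ}
    (hπ : Integrable π) (hπ0 : ∀ x, 0 ≤ π x)
    (hπ_tail : Tendsto (fun x => π x * Real.exp (α * x)) atTop (nhds C)) :
    ∃ c > (0 : ℝ), ∃ b, ∀ x ≥ b,
      (∫ z, z ∂μ + c) * π x ≤ ∫ z in Ioo 0 x, μ.real (Ioi (x - z)) * π z := by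
  obtain ⟨U, hU, hmU⟩ := exists_mean_lt_integral_exp_mul_tail hμne hμ hint hα
  have hm := integral_id_pos hμne hμ hint
  set m := ∫ z, z ∂μ
  set S := ∫ u in 0..U, μ.real (Ioi u) * Real.exp (α * u) with hS
  have hS0 : 0 < S := hm.trans hmU
  obtain ⟨b, hb⟩ := eventually_mul_exp_mul_le hC hπ_tail (q := (m + S) / (2 * S))
    (by positivity) (by rw [div_lt_one (by positivity)]; linarith) U
  refine ⟨(S - m) / 2, by linarith, max b (U + 1), fun x hx => ?_⟩
  have hxb : b ≤ x := (le_max_left _ _).trans hx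
  have hxU : U + 1 ≤ x := (le_max_right _ _).trans hx
  set q := (m + S) / (2 * S) with hq
  have hqS : q * S = (m + S) / 2 := by
    rw [hq]
    field_simp
  have hshift : S = ∫ z in (x - U)..x, μ.real (Ioi (x - z)) * Real.exp (α * (x - z)) := by
    rw [intervalIntegral.integral_comp_sub_left
      (fun u => μ.real (Ioi u) * Real.exp (α * u)) x, sub_self, sub_sub_cancel]
  have hii : IntervalIntegrable (fun z => μ.real (Ioi (x - z)) * Real.exp (α * (x - z))) volume
      (x - U) x := by
    refine IntervalIntegrable.mul_continuousOn ?_ (by fun_prop)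
    exact Monotone.intervalIntegrable
      fun z w h => antitone_measureReal_Ioi μ (sub_le_sub_left h x)
  have hUx : x - U ≤ x := by linarith
  calc (m + (S - m) / 2) * π x = q * π x * S := by
        rw [mul_right_comm, hqS]
        ring
    _ = ∫ z in (x - U)..x, q * π x * (μ.real (Ioi (x - z)) * Real.exp (α * (x - z))) := by
        rw [intervalIntegral.integral_const_mul, ← hshift]
    _ ≤ ∫ z in (x - U)..x, μ.real (Ioi (x - z)) * π z := by
        refine intervalIntegral.integral_mono_on hUx (hii.const_mul _)
          ((intervalIntegrable_iff_integrableOn_Ioc_of_le hUx).2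
            (integrableOn_tail_mul hπ x _)) fun z hz => ?_
        have := mul_le_mul_of_nonneg_left (hb x hxb z hz)
          (measureReal_nonneg (μ := μ) (s := Ioi (x - z)))
        linarith
    _ = ∫ z in Ioo (x - U) x, μ.real (Ioi (x - z)) * π z := by
        rw [intervalIntegral.integral_of_le hUx, integral_Ioc_eq_integral_Ioo]
    _ ≤ ∫ z in Ioo 0 x, μ.real (Ioi (x - z)) * π z :=
        setIntegral_mono_set (integrableOn_tail_mul hπ x _)
          (Eventually.of_forall fun z => mul_nonneg measureReal_nonneg (hπ0 z))
          (Ioo_subset_Ioo_left (by linarith)).eventuallyLE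

end Tail

section LinearGrowth

variable {f : ℝ → ℝ} {b : ℝ}

lemma exists_le_add_of_eq_one_add (hf : ContinuousOn f (Ioi 0)) (hlin : ∀ x ≥ b, f x = 1 + x)
    {a : ℝ} (ha : 0 < a) : ∃ B ≥ (0 : ℝ), ∀ y ≥ a, f y ≤ B + 1 + y := by
  obtain ⟨B, hB⟩ := (isCompact_Icc (a := a) (b := b)).bddAbove_image
    (hf.mono fun y hy => ha.trans_le hy.1)
  refine ⟨max B 0, le_max_right _ _, fun y hy => ?_⟩
  rcases le_total b y with h | h
  · rw [hlin y h]
    linarith [le_max_right B 0]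
  · have := hB (mem_image_of_mem f ⟨hy, h⟩)
    linarith [le_max_left B 0]

lemma integrable_translate_sub {μ : Measure ℝ} [IsFiniteMeasure μ]
    (hpos : ∀ᵐ z ∂μ, (0 : ℝ) < z) (hint : Integrable (fun z : ℝ => z) μ)
    (hf : ContinuousOn f (Ioi 0)) (hf1 : ∀ x > 0, 1 ≤ f x) (hlin : ∀ x ≥ b, f x = 1 + x)
    {x : ℝ} (hx : 0 < x) : Integrable (fun z => f (x + z) - f x) μ := by
  obtain ⟨B, -, hB⟩ := exists_le_add_of_eq_one_add hf hlin hx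
  refine Integrable.sub ?_ (integrable_const _)
  refine Integrable.mono' ((integrable_const (B + 1 + x)).add hint) ?_ ?_
  · rw [← Measure.restrict_eq_self_of_ae_mem hpos]
    refine ContinuousOn.aestronglyMeasurable ?_ measurableSet_Ioi
    exact hf.comp (by fun_prop) fun z hz => add_pos hx hz
  · filter_upwards [hpos] with z hz
    rw [Real.norm_of_nonneg (by linarith [hf1 (x + z) (by linarith)])]
    have := hB (x + z) (by linarith)
    simp only [Pi.add_apply]
    linarith

/-- If `f` is `1 - log` near `0` and grows linearly at infinity, the mean jump increment of `f`
started from `x` tends to `-∞` as `x` decreases to `0`. -/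
lemma exists_integral_translate_sub_le {μ : Measure ℝ} [IsFiniteMeasure μ] (hμne : μ ≠ 0)
    (hμ : μ (Iic 0) = 0) (hint : Integrable (fun z : ℝ => z) μ)
    (hf : ContinuousOn f (Ioi 0)) (hf1 : ∀ x > 0, 1 ≤ f x) (hlin : ∀ x ≥ b, f x = 1 + x)
    {ε : ℝ} (hε : 0 < ε) (hlog : ∀ x ∈ Ioc 0 ε, f x = 1 - Real.log x) (T : ℝ) :
    ∃ a > (0 : ℝ), ∀ x > 0, x < a → ∫ z, (f (x + z) - f x) ∂μ ≤ T := by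
  have hpos := ae_pos_of_measure_Iic_eq_zero hμ
  obtain ⟨δ, hδ, hδε, hδμ⟩ := exists_measureReal_Ioi_pos hμne hμ (half_pos hε)
  obtain ⟨B, -, hB⟩ := exists_le_add_of_eq_one_add hf hlin hδ
  set R := ∫ z in Ioi δ, (B + 1 + z) ∂μ with hR
  refine ⟨min (min (ε / 2) 1) (Real.exp ((T - R) / μ.real (Ioi δ))), by positivity,
    fun x hx hxa => ?_⟩
  simp only [lt_min_iff] at hxa
  obtain ⟨⟨hxε, hx1⟩, hxe⟩ := hxa
  rw [← Real.log_lt_iff_lt_exp hx, lt_div_iff₀ hδμ] at hxe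
  have hi : Integrable (fun z : ℝ => B + 1 + z) μ := (integrable_const _).add hint
  calc ∫ z, (f (x + z) - f x) ∂μ
      ≤ ∫ z, (Ioi δ).indicator (fun z => B + 1 + z + Real.log x) z ∂μ := by
        refine integral_mono_ae (integrable_translate_sub hpos hint hf hf1 hlin hx)
          ((hi.add (integrable_const _)).indicator measurableSet_Ioi) ?_
        filter_upwards [hpos] with z hz
        rw [hlog x ⟨hx, by linarith⟩]
        by_cases hzδ : z ∈ Ioi δ
        · rw [indicator_of_mem hzδ]
          have hzδ' : δ < z := hzδ
          linarith [hB (x + z) (by linarith)]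
        · rw [indicator_of_notMem hzδ]
          have hzδ' : z ≤ δ := not_lt.1 hzδ
          rw [hlog (x + z) ⟨by linarith, by linarith⟩]
          linarith [Real.log_le_log hx (by linarith : x ≤ x + z)]
    _ = R + Real.log x * μ.real (Ioi δ) := by
        rw [integral_indicator measurableSet_Ioi,
          integral_add hi.integrableOn (integrable_const _), setIntegral_const, smul_eq_mul, ← hR,
          mul_comm (Real.log x)]
    _ ≤ T := by linarith

end LinearGrowth

/-- the Foster–Lyapunov drift inequality (eq_fle) for the generator
`G f₀(x) = φ(x) f₀'(x) + ∫ (f₀(x+z) − f₀(x)) dμ(z)` with the norm-like function `f₀`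
of Lemma 4.1, under Assumptions (b1) and (b2) of the paper. -/
theorem foster_lyapunov_drift_inequality
    (μ : Measure ℝ) [IsFiniteMeasure μ] (hμne : μ ≠ 0) (hμ : μ (Iic 0) = 0)
    (hmom : ∫⁻ z in Ioi 0, ENNReal.ofReal z ∂μ < ⊤)
    (α C C' x₀ : ℝ) (hα : 0 < α) (hC : 0 < C) (hC' : 0 < C') (hx₀ : 0 < x₀)
    (π : ℝ → ℝ) (hπ_meas : Measurable π) (hπ_int : Integrable π)
    (hπ_nonneg : ∀ x, 0 ≤ π x) (hπ_zero : ∀ x ≤ 0, π x = 0)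
    (hπ_pos : ∀ z > (0 : ℝ), 0 < π z)
    (hπ_tail : Tendsto (fun x => π x * Real.exp (α * x)) atTop (nhds C))
    (hπ_near0 : ∀ x ∈ Ioc 0 x₀, ∫ z in Ioo 0 x, π z ≤ C' * x * π x)
    (hπ_compact : ∀ K : Set ℝ, K ⊆ Ioi 0 → IsCompact K →
      ∃ δ > (0 : ℝ), ∀ x ∈ K, δ ≤ π x)
    (φ : ℝ → ℝ)
    (hφ : ∀ x > (0 : ℝ),
      φ x = -(1 / π x) * ∫ z in Ioo 0 x, (μ (Ioi (x - z))).toReal * π z)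
    (ε : ℝ) (hε : ε ∈ Ioo (0 : ℝ) 1)
    (f₀ : ℝ → ℝ) (hf₀_diff : ContDiffOn ℝ 1 f₀ (Ioi 0))
    (hf₀_log : ∀ x ∈ Ioc (0 : ℝ) ε, f₀ x = 1 - Real.log x)
    (hf₀_lin : ∀ x ≥ 1 / ε, f₀ x = 1 + x)
    (hf₀_ge : ∀ x > (0 : ℝ), 1 ≤ f₀ x) :
    ∃ c > (0 : ℝ), ∃ d ≥ (0 : ℝ), ∃ K : Set ℝ, IsCompact K ∧ K ⊆ Ioi 0 ∧
      ∀ x > (0 : ℝ),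
        φ x * deriv f₀ x + ∫ z in Ioi 0, (f₀ (x + z) - f₀ x) ∂μ
          ≤ -c + d * K.indicator (fun _ => (1 : ℝ)) x := by
  have hpos := ae_pos_of_measure_Iic_eq_zero hμ
  have hrestrict : μ.restrict (Ioi 0) = μ := Measure.restrict_eq_self_of_ae_mem hpos
  rw [hrestrict] at hmom ⊢
  have hint : Integrable (fun z : ℝ => z) μ := by
    refine ⟨aestronglyMeasurable_id, ?_⟩
    rw [hasFiniteIntegral_iff_ofReal (hpos.mono fun z hz => hz.le)]
    exact hmom
  have hcont : ContinuousOn f₀ (Ioi 0) := hf₀_diff.continuousOn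
  have hε0 : 0 < ε := hε.1
  set I : ℝ → ℝ := fun x => ∫ z in Ioo 0 x, μ.real (Ioi (x - z)) * π z with hI
  have hφI : ∀ x > 0, φ x = -(1 / π x) * I x := hφ
  have hI0 : ∀ x, 0 ≤ I x := fun x =>
    integral_nonneg fun z => mul_nonneg measureReal_nonneg (hπ_nonneg z)
  set M := μ.real univ with hM
  have hM0 : 0 ≤ M := measureReal_nonneg
  obtain ⟨c, hc, b₁, hb₁⟩ := exists_mean_add_mul_le_setIntegral_tail_mul hμne hμ hint hα hC
    hπ_int hπ_nonneg hπ_tail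
  have hlarge : ∀ x > max b₁ (1 / ε),
      φ x * deriv f₀ x + ∫ z, (f₀ (x + z) - f₀ x) ∂μ ≤ -c := by
    intro x hx
    rw [gt_iff_lt, max_lt_iff] at hx
    have hx0 : 0 < x := lt_trans (by positivity) hx.2
    have hd : deriv f₀ x = 1 := by
      have : f₀ =ᶠ[nhds x] fun y => 1 + y := by
        filter_upwards [lt_mem_nhds hx.2] with y hy using hf₀_lin y hy.le
      rw [this.deriv_eq]
      simp
    have hjump : ∫ z, (f₀ (x + z) - f₀ x) ∂μ = ∫ z, z ∂μ := by
      refine integral_congr_ae ?_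
      filter_upwards [hpos] with z hz
      rw [hf₀_lin x hx.2.le, hf₀_lin (x + z) (by linarith [hx.2])]
      ring
    have hle : ∫ z, z ∂μ + c ≤ I x / π x := by
      rw [le_div_iff₀ (hπ_pos x hx0)]
      exact hb₁ x hx.1.le
    have hφx : φ x = -(I x / π x) := by
      rw [hφI x hx0]
      ring
    rw [hd, hjump, hφx]
    linarith
  obtain ⟨a₁, ha₁, hjump₁⟩ := exists_integral_translate_sub_le hμne hμ hint hcont hf₀_ge hf₀_lin
    hε0 hf₀_log (-c - M * C')
  have hsmall : ∀ x > 0, x < min a₁ (min ε x₀) →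
      φ x * deriv f₀ x + ∫ z, (f₀ (x + z) - f₀ x) ∂μ ≤ -c := by
    intro x hx hxa
    rw [lt_min_iff, lt_min_iff] at hxa
    obtain ⟨hxa, hxε, hxx₀⟩ := hxa
    have hd : deriv f₀ x = -x⁻¹ := by
      have : f₀ =ᶠ[nhds x] fun y => 1 - Real.log y := by
        filter_upwards [Ioo_mem_nhds hx hxε] with y hy using hf₀_log y ⟨hy.1, hy.2.le⟩
      rw [this.deriv_eq, deriv_const_sub, Real.deriv_log]
    have hπx := hπ_pos x hx
    have hIx : I x ≤ M * C' * (x * π x) := by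
      calc I x ≤ M * ∫ z in Ioo 0 x, π z := setIntegral_tail_mul_le hπ_int hπ_nonneg x _
        _ ≤ M * (C' * x * π x) := mul_le_mul_of_nonneg_left (hπ_near0 x ⟨hx, hxx₀.le⟩) hM0
        _ = M * C' * (x * π x) := by ring
    have hdrift : φ x * deriv f₀ x ≤ M * C' := by
      have : φ x * deriv f₀ x = I x / (x * π x) := by
        rw [hd, hφI x hx]
        field_simp
      rw [this, div_le_iff₀ (by positivity)]
      exact hIx
    linarith [hjump₁ x hx hxa]
  set a := min a₁ (min ε x₀) with ha
  have ha0 : 0 < a := by positivity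
  set b := max b₁ (1 / ε)
  have hKsub : Icc a b ⊆ Ioi 0 := fun x hx => ha0.trans_le hx.1
  obtain ⟨δ, hδ, hδπ⟩ := hπ_compact (Icc a b) hKsub isCompact_Icc
  obtain ⟨D, hD⟩ := (isCompact_Icc (a := a) (b := b)).exists_bound_of_continuousOn
    ((hf₀_diff.continuousOn_deriv_of_isOpen isOpen_Ioi le_rfl).mono hKsub)
  obtain ⟨B, hB0, hB⟩ := exists_le_add_of_eq_one_add hcont hf₀_lin ha0
  have hmiddle : ∀ x ∈ Icc a b, φ x * deriv f₀ x + ∫ z, (f₀ (x + z) - f₀ x) ∂μ ≤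
      M * (∫ z, π z) / δ * D + ∫ z, (B + b + z) ∂μ := by
    intro x hx
    have hx0 : 0 < x := hKsub hx
    have hIx : I x ≤ M * ∫ z, π z := by
      refine (setIntegral_tail_mul_le hπ_int hπ_nonneg x _).trans
        (mul_le_mul_of_nonneg_left ?_ hM0)
      exact setIntegral_le_integral hπ_int (Eventually.of_forall hπ_nonneg)
    have hφx : |φ x| ≤ M * (∫ z, π z) / δ := by
      rw [hφI x hx0, neg_mul, abs_neg, one_div_mul_eq_div,
        abs_of_nonneg (div_nonneg (hI0 x) (hπ_nonneg x))]
      exact div_le_div₀ ((hI0 x).trans hIx) hIx hδ (hδπ x hx)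
    refine add_le_add ?_ ?_
    · calc φ x * deriv f₀ x ≤ |φ x| * |deriv f₀ x| := by
            rw [← abs_mul]
            exact le_abs_self _
        _ ≤ M * (∫ z, π z) / δ * D :=
            mul_le_mul hφx (hD x hx) (abs_nonneg _) ((abs_nonneg _).trans hφx)
    · refine integral_mono_ae (integrable_translate_sub hpos hint hcont hf₀_ge hf₀_lin hx0)
        ((integrable_const _).add hint) ?_
      filter_upwards [hpos] with z hz
      linarith [hB (x + z) (by linarith [hx.1]), hf₀_ge x hx0, hx.2]
  refine ⟨c, hc, max (M * (∫ z, π z) / δ * D + ∫ z, (B + b + z) ∂μ + c) 0, le_max_right _ _,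
    Icc a b, isCompact_Icc, hKsub, fun x hx => ?_⟩
  by_cases hxK : x ∈ Icc a b
  · rw [indicator_of_mem hxK, mul_one]
    linarith [hmiddle x hxK,
      le_max_left (M * (∫ z, π z) / δ * D + ∫ z, (B + b + z) ∂μ + c) 0]
  · rw [indicator_of_notMem hxK, mul_zero, add_zero]
    rcases lt_or_ge x a with h | h
    · exact hsmall x hx h
    · exact hlarge x (not_le.1 fun hxb => hxK ⟨h, hxb⟩)
end
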